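/- arXiv:1906.00764 — 3 statements merged into one kernel-verified Lean document; each statement's English description precedes it below -/
import Mathlib

section
/- Let σ: ℝ → ℝ be continuous and not an algebraic polynomial, and let d ∈ ℕ. Then for every compact set K ⊆ ℝ^d, the family Σ(σ, A^d) of functions of the form x ↦ ∑_{i=1}^n α_i σ(w_i · x + b_i) (with n ∈ ℕ, α_i, b_i ∈ ℝ, w_i ∈ ℝ^d), restricted to K, is dense in the space C(K, ℝ) of continuous real-valued functions on K equipped with the supremum metric. That is, for every continuous f: K → ℝ and every ε > 0 there exist n ∈ ℕ, α_i, b_i ∈ ℝ, w_i ∈ ℝ^d such that sup_{x ∈ K} |f(x) − ∑_{i=1}^n α_i σ(w_i · x + b_i)| < ε. -/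
open MeasureTheory Filter Topology Set
open scoped ContDiff Convolution Nat

/-- The subspace of polynomial functions of degree at most `k`. -/
noncomputable def polyFunctions (k : ℕ) : Submodule ℝ (ℝ → ℝ) :=
  Submodule.span ℝ (range fun (i : Fin (k + 1)) (x : ℝ) => x ^ (i : ℕ))

theorem isClosed_polyFunctions (k : ℕ) : IsClosed (polyFunctions k : Set (ℝ → ℝ)) := by
  have : FiniteDimensional ℝ (polyFunctions k) :=
    FiniteDimensional.span_of_finite ℝ (finite_range _)
  exact Submodule.closed_of_finiteDimensional _

theorem exists_polynomial_of_mem_polyFunctions {k : ℕ} {f : ℝ → ℝ} (hf : f ∈ polyFunctions k) :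
    ∃ q : Polynomial ℝ, ∀ t, f t = q.eval t := by
  obtain ⟨c, rfl⟩ := (Submodule.mem_span_range_iff_exists_fun ℝ).1 hf
  refine ⟨∑ i, Polynomial.C (c i) * Polynomial.X ^ (i : ℕ), fun t => ?_⟩
  simp [Polynomial.eval_finsetSum]

theorem mem_polyFunctions_of_iteratedDeriv_eq_zero {k : ℕ} {ψ : ℝ → ℝ} (hψ : ContDiff ℝ ∞ ψ)
    (h : ∀ x, iteratedDeriv k ψ x = 0) : ψ ∈ polyFunctions k := by
  have h1 : ∀ x, iteratedDeriv (k + 1) ψ x = 0 := fun x => by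
    rw [iteratedDeriv_succ, funext h]; simp
  have key : ψ = ∑ i : Fin (k + 1),
      (((i : ℕ) ! : ℝ)⁻¹ * iteratedDeriv i ψ 0) • fun x : ℝ => x ^ (i : ℕ) := by
    funext x
    rw [Finset.sum_apply]
    simp only [Pi.smul_apply, smul_eq_mul]
    rw [Fin.sum_univ_eq_sum_range (fun i => ((i ! : ℝ)⁻¹ * iteratedDeriv i ψ 0) * x ^ i)]
    rcases eq_or_ne (0 : ℝ) x with rfl | hx
    · simp [Finset.sum_range_succ']
    · have hu : UniqueDiffOn ℝ (uIcc 0 x) := uniqueDiffOn_uIcc hx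
      have hit : ∀ i, ∀ t ∈ uIcc 0 x,
          iteratedDerivWithin i ψ (uIcc 0 x) t = iteratedDeriv i ψ t := fun i t ht =>
        iteratedDerivWithin_eq_iteratedDeriv hu (hψ.of_le (by exact_mod_cast le_top)).contDiffAt ht
      have ht := taylor_integral_remainder (f := ψ) (x := x) (x₀ := 0) (n := k)
        (hψ.of_le (by exact_mod_cast le_top)).contDiffOn
      rw [intervalIntegral.integral_congr (g := fun _ => (0 : ℝ))
        (fun t ht => by simp [hit _ t ht, h1])] at ht
      simp only [intervalIntegral.integral_zero, taylor_within_apply, smul_eq_mul, sub_zero] at ht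
      rw [sub_eq_zero.1 ht]
      refine Finset.sum_congr rfl fun i _ => ?_
      rw [hit i 0 left_mem_uIcc]
      ring
  rw [key]
  exact Submodule.sum_mem _ fun i _ => Submodule.smul_mem _ _ (Submodule.subset_span ⟨i, rfl⟩)

theorem Submodule.integral_mem_of_isClosed {α E : Type*} [MeasurableSpace α] {μ : Measure α}
    [NormedAddCommGroup E] [NormedSpace ℝ E] [CompleteSpace E] {S : Submodule ℝ E}
    (hS : IsClosed (S : Set E)) {g : α → E} (hg : ∀ a, g a ∈ S) : ∫ a, g a ∂μ ∈ S := by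
  have : CompleteSpace S := hS.completeSpace_coe
  have := S.subtypeₗᵢ.integral_comp_comm (μ := μ) (fun a => (⟨g a, hg a⟩ : S))
  simp only [Submodule.coe_subtypeₗᵢ, Submodule.subtype_apply] at this
  rw [this]
  exact Subtype.property _

theorem Submodule.mem_of_forall_intervalIntegral_mem {E : Type*}
    [NormedAddCommGroup E] [NormedSpace ℝ E] [CompleteSpace E] {S : Submodule ℝ E}
    (hS : IsClosed (S : Set E)) {g : ℝ → E} (hg : Continuous g)
    (h : ∀ t, ∫ s in (0 : ℝ)..t, g s ∈ S) (t : ℝ) : g t ∈ S := by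
  have hd : HasDerivAt (fun u => ∫ s in (0 : ℝ)..u, g s) (g t) t :=
    intervalIntegral.integral_hasDerivAt_right (hg.intervalIntegrable _ _)
      hg.stronglyMeasurable.stronglyMeasurableAtFilter hg.continuousAt
  refine hS.mem_of_tendsto hd.tendsto_slope (Eventually.of_forall fun u => ?_)
  exact S.smul_mem _ (S.sub_mem (h u) (h t))

section Ridge

variable {X : Type*} [TopologicalSpace X]

/-- The function `x ↦ ψ (t * y x + b)`. -/
def ridge (y : C(X, ℝ)) (ψ : C(ℝ, ℝ)) (t b : ℝ) : C(X, ℝ) :=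
  ⟨fun x => ψ (t * y x + b), by fun_prop⟩

theorem continuous_ridge {T : Type*} [TopologicalSpace T] (y : C(X, ℝ)) (ψ : C(ℝ, ℝ))
    {u v : T → ℝ} (hu : Continuous u) (hv : Continuous v) :
    Continuous fun s => ridge y ψ (u s) (v s) := by
  refine ContinuousMap.continuous_of_continuous_uncurry _ ?_
  simp only [Function.uncurry_def, ridge, ContinuousMap.coe_mk]
  fun_prop

variable [CompactSpace X] {S : Submodule ℝ C(X, ℝ)}

theorem pow_mul_ridge_mem (hS : IsClosed (S : Set C(X, ℝ))) (y : C(X, ℝ)) {ψ : ℝ → ℝ}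
    (hψ : ContDiff ℝ ∞ ψ) (h : ∀ t b, ridge y ⟨ψ, hψ.continuous⟩ t b ∈ S) (k : ℕ) (t b : ℝ) :
    y ^ k * ridge y ⟨iteratedDeriv k ψ,
      hψ.continuous_iteratedDeriv k (by exact_mod_cast le_top)⟩ t b ∈ S := by
  induction k generalizing t with
  | zero => simpa using h t b
  | succ k ih =>
    have hcont : ∀ k, Continuous (iteratedDeriv k ψ) := fun k =>
      hψ.continuous_iteratedDeriv k (by exact_mod_cast le_top)
    have hg : Continuous fun t => y ^ (k + 1) * ridge y ⟨_, hcont (k + 1)⟩ t b :=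
      continuous_const.mul (continuous_ridge y _ continuous_id continuous_const)
    refine S.mem_of_forall_intervalIntegral_mem hS hg (fun u => ?_) t
    convert S.sub_mem (ih u) (ih 0) using 1
    ext x
    have e := (ContinuousMap.evalCLM ℝ x).intervalIntegral_comp_comm
      (hg.intervalIntegrable (μ := volume) 0 u)
    simp only [ContinuousMap.evalCLM_apply] at e
    rw [← e]
    refine intervalIntegral.integral_eq_sub_of_hasDerivAt
      (f := fun t => (y ^ k * ridge y ⟨_, hcont k⟩ t b) x) (fun s _ => ?_) ?_
    · have hd : HasDerivAt (iteratedDeriv k ψ) (iteratedDeriv (k + 1) ψ (s * y x + b))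
          (s * y x + b) := by
        rw [iteratedDeriv_succ]
        exact (hψ.differentiable_iteratedDeriv k
          (by exact_mod_cast WithTop.coe_lt_top k) _).hasDerivAt
      have hl : HasDerivAt (fun s => s * y x + b) (y x) s := by
        simpa using ((hasDerivAt_id s).mul_const (y x)).add_const b
      refine ((hd.comp s hl).const_mul (y x ^ k)).congr_deriv ?_
      simp only [ridge, ContinuousMap.mul_apply, ContinuousMap.pow_apply, ContinuousMap.coe_mk]
      ring
    · exact ((ContinuousMap.evalCLM ℝ x).continuous.comp hg).intervalIntegrable _ _

theorem ridge_convolution_mem (hS : IsClosed (S : Set C(X, ℝ))) (y : C(X, ℝ)) {σ η : ℝ → ℝ}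
    (hσ : Continuous σ) (hη : Continuous η) (hηc : HasCompactSupport η)
    (h : ∀ t b, ridge y ⟨σ, hσ⟩ t b ∈ S)
    (hc : Continuous (η ⋆[ContinuousLinearMap.lsmul ℝ ℝ, volume] σ)) (t b : ℝ) :
    ridge y ⟨η ⋆[ContinuousLinearMap.lsmul ℝ ℝ, volume] σ, hc⟩ t b ∈ S := by
  have hcont : Continuous fun s => ridge y ⟨σ, hσ⟩ t (b - s) :=
    continuous_ridge y _ continuous_const (continuous_const.sub continuous_id)
  have hint : Integrable (fun s => η s • ridge y ⟨σ, hσ⟩ t (b - s)) :=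
    (hη.smul hcont).integrable_of_hasCompactSupport hηc.smul_right
  have : ridge y ⟨η ⋆[ContinuousLinearMap.lsmul ℝ ℝ, volume] σ, hc⟩ t b =
      ∫ s, η s • ridge y ⟨σ, hσ⟩ t (b - s) := by
    ext x
    rw [ContinuousMap.integral_apply hint]
    simp only [ridge, ContinuousMap.coe_mk, convolution_lsmul, ContinuousMap.smul_apply,
      add_sub_assoc]
  rw [this]
  exact Submodule.integral_mem_of_isClosed hS fun s => S.smul_mem _ (h _ _)

theorem pow_mem_of_ridge_mem (hS : IsClosed (S : Set C(X, ℝ))) (y : C(X, ℝ)) {σ : ℝ → ℝ}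
    (hσ : Continuous σ) (hpoly : ¬ ∃ q : Polynomial ℝ, ∀ t : ℝ, σ t = q.eval t)
    (h : ∀ t b, ridge y ⟨σ, hσ⟩ t b ∈ S) (k : ℕ) : y ^ k ∈ S := by
  by_contra hk
  have hmoll : ∀ η : ContDiffBump (0 : ℝ),
      (η.normed volume ⋆[ContinuousLinearMap.lsmul ℝ ℝ, volume] σ) ∈ polyFunctions k := by
    intro η
    have hψ : ContDiff ℝ ∞ (η.normed volume ⋆[ContinuousLinearMap.lsmul ℝ ℝ, volume] σ) :=
      η.hasCompactSupport_normed.contDiff_convolution_left _ η.contDiff_normed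
        hσ.locallyIntegrable
    refine mem_polyFunctions_of_iteratedDeriv_eq_zero hψ fun b => ?_
    by_contra hb
    have := pow_mul_ridge_mem hS y hψ (ridge_convolution_mem hS y hσ
      η.continuous_normed η.hasCompactSupport_normed h hψ.continuous) k 0 b
    refine hk ((S.smul_mem_iff hb).1 ?_)
    convert this using 1
    ext x
    simp [ridge, mul_comm]
  let η : ℕ → ContDiffBump (0 : ℝ) := fun n =>
    ⟨1 / (n + 1) / 2, 1 / (n + 1), by positivity, half_lt_self (by positivity)⟩
  have hlim : Tendsto (fun n => (η n).rOut) atTop (𝓝 0) :=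
    tendsto_one_div_add_atTop_nhds_zero_nat
  refine hpoly (exists_polynomial_of_mem_polyFunctions (k := k)
    ((isClosed_polyFunctions k).mem_of_tendsto (tendsto_pi_nhds.2 fun x =>
      ContDiffBump.convolution_tendsto_right_of_continuous (μ := volume) hlim hσ x)
      (Eventually.of_forall fun n => hmoll (η n))))

theorem exp_mem_of_pow_mem (hS : IsClosed (S : Set C(X, ℝ))) (y : C(X, ℝ))
    (h : ∀ k : ℕ, y ^ k ∈ S) : NormedSpace.exp y ∈ S :=
  hS.mem_of_tendsto (NormedSpace.exp_series_hasSum_exp' (𝕂 := ℝ) y)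
    (Eventually.of_forall fun _ => S.sum_mem fun k _ => S.smul_mem _ (h k))

theorem ContinuousMap.exp_apply (y : C(X, ℝ)) (x : X) :
    NormedSpace.exp y x = Real.exp (y x) := by
  have := NormedSpace.map_exp (ContinuousMap.evalAlgHom ℝ ℝ x)
    ((ContinuousMap.evalCLM ℝ x).continuous) y
  rw [Real.exp_eq_exp_ℝ]
  exact this

end Ridge

/-- The linear functional `x ↦ ∑ j, w j * x j` on a subset of `ℝ^d`. -/
def dotMap {d : ℕ} (K : Set (Fin d → ℝ)) (w : Fin d → ℝ) : C(K, ℝ) :=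
  ⟨fun x => ∑ j, w j * (x : Fin d → ℝ) j, continuous_finsetSum _ fun j _ =>
    continuous_const.mul ((continuous_apply j).comp continuous_subtype_val)⟩

theorem submodule_eq_top_of_exp_dotMap_mem {d : ℕ} {K : Set (Fin d → ℝ)} [CompactSpace K]
    {S : Submodule ℝ C(K, ℝ)} (hS : IsClosed (S : Set C(K, ℝ)))
    (h : ∀ w, NormedSpace.exp (dotMap K w) ∈ S) : S = ⊤ := by
  let M : Submonoid C(K, ℝ) :=
    { carrier := range fun w => NormedSpace.exp (dotMap K w)
      one_mem' := ⟨0, by ext x; simp [ContinuousMap.exp_apply, dotMap]⟩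
      mul_mem' := by
        rintro _ _ ⟨v, rfl⟩ ⟨w, rfl⟩
        refine ⟨v + w, ?_⟩
        ext x
        simp [ContinuousMap.exp_apply, dotMap, add_mul, Finset.sum_add_distrib, Real.exp_add] }
  let A := Algebra.adjoin ℝ (M : Set C(K, ℝ))
  have hAS : Subalgebra.toSubmodule A ≤ S := by
    rw [Algebra.adjoin_eq_span, Submonoid.closure_eq, Submodule.span_le]
    rintro _ ⟨w, rfl⟩
    exact h w
  have hsep : A.SeparatesPoints := by
    intro x z hxz
    obtain ⟨j, hj⟩ := Function.ne_iff.1 (Subtype.coe_injective.ne hxz)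
    refine ⟨_, ⟨_, Algebra.subset_adjoin ⟨Pi.single j 1, rfl⟩, rfl⟩, ?_⟩
    simpa [ContinuousMap.exp_apply, dotMap, Pi.single_apply] using hj
  refine eq_top_iff.2 fun f _ => ?_
  exact closure_minimal hAS hS
    (ContinuousMap.continuousMap_mem_subalgebra_closure_of_separatesPoints A hsep f)

/-- Universal approximation theorem on compact subsets of ℝ^d: for a continuous,
non-polynomial activation σ, the family Σ(σ, A^d) of one-hidden-layer networks
is dense (w.r.t. the supremum metric) in the continuous functions on any compact
K ⊆ ℝ^d. -/
theorem stmt_0 (σ : ℝ → ℝ) (hσ_cont : Continuous σ)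
    (hσ_nonpoly : ¬ ∃ q : Polynomial ℝ, ∀ t : ℝ, σ t = q.eval t)
    (d : ℕ) (K : Set (Fin d → ℝ)) (hK : IsCompact K)
    (f : (Fin d → ℝ) → ℝ) (hf : ContinuousOn f K) :
    ∀ ε > 0, ∃ (n : ℕ) (α : Fin n → ℝ) (b : Fin n → ℝ) (w : Fin n → Fin d → ℝ),
      ∀ x ∈ K, |f x - ∑ i, α i * σ ((∑ j, w i j * x j) + b i)| < ε := by
  intro ε hε
  have : CompactSpace K := isCompact_iff_compactSpace.1 hK
  let g : (Fin d → ℝ) × ℝ → C(K, ℝ) := fun p => ridge (dotMap K p.1) ⟨σ, hσ_cont⟩ 1 p.2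
  let S : Submodule ℝ C(K, ℝ) := (Submodule.span ℝ (range g)).topologicalClosure
  have hS : IsClosed (S : Set C(K, ℝ)) := Submodule.isClosed_topologicalClosure _
  have hmem : ∀ w t b, ridge (dotMap K w) ⟨σ, hσ_cont⟩ t b ∈ S := fun w t b => by
    refine Submodule.le_topologicalClosure _ (Submodule.subset_span ⟨(t • w, b), ?_⟩)
    ext x
    simp [g, ridge, dotMap, Finset.mul_sum, mul_assoc]
  have htop : S = ⊤ := submodule_eq_top_of_exp_dotMap_mem hS fun w =>
    exp_mem_of_pow_mem hS _ (pow_mem_of_ridge_mem hS _ hσ_cont hσ_nonpoly (hmem w))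
  have hfS : (⟨K.domRestrict f, hf.domRestrict⟩ : C(K, ℝ)) ∈
      closure (Submodule.span ℝ (range g) : Set C(K, ℝ)) := by
    rw [← Submodule.topologicalClosure_coe]
    change _ ∈ S
    rw [htop]
    trivial
  obtain ⟨u, hu, hfu⟩ := Metric.mem_closure_iff.1 hfS ε hε
  obtain ⟨n, α, v, rfl⟩ := Submodule.mem_span_set'.1 hu
  choose p hp using fun i => (v i).2
  refine ⟨n, α, fun i => (p i).2, fun i => (p i).1, fun x hx => ?_⟩
  have := (ContinuousMap.dist_lt_iff hε).1 hfu ⟨x, hx⟩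
  simpa [← hp, g, ridge, dotMap, Real.dist_eq, ContinuousMap.sum_apply, domRestrict_apply]
    using this
end

section
/- Let X be a compact metric space, let P be a compact (in the weak-* topology) set of Borel probability measures on X, and let F be a dense subset of C(X, ℝ). Then ΣΠ(F) is dense in C(P, ℝ): for every continuous function f: P → ℝ and every ε > 0 there exist n, l_i ∈ ℕ, α_i ∈ ℝ, and f_{ij} ∈ F such that sup_{p ∈ P} |f(p) − ∑_{i=1}^n α_i ∏_{j=1}^{l_i} ∫ f_{ij} dp| < ε. -/
open MeasureTheory

/-- Integration against a fixed probability measure is continuous on `C(X, ℝ)`. -/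
theorem ContinuousMap.continuous_integral_left {X : Type*} [TopologicalSpace X] [CompactSpace X]
    [MeasurableSpace X] [OpensMeasurableSpace X] (μ : Measure X) [IsProbabilityMeasure μ] :
    Continuous fun g : C(X, ℝ) ↦ ∫ x, g x ∂μ := by
  have h_int (g : C(X, ℝ)) : Integrable g μ :=
    (BoundedContinuousFunction.mkOfCompact g).integrable μ
  refine (LipschitzWith.of_dist_le_mul (K := 1) fun g h ↦ ?_).continuous
  rw [dist_eq_norm, ← integral_sub (h_int g) (h_int h)]
  have h_bound := norm_integral_le_of_norm_le_const (μ := μ) (f := fun x ↦ g x - h x)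
    (C := dist g h) (.of_forall fun x ↦ by
      rw [← dist_eq_norm]
      exact ContinuousMap.dist_apply_le_dist x)
  simpa using h_bound

/-- The function `p ↦ ∫ g dp` on a set of probability measures. -/
@[simps]
noncomputable def integralOn {X : Type*} [TopologicalSpace X] [CompactSpace X]
    [MeasurableSpace X] [OpensMeasurableSpace X] (P : Set (ProbabilityMeasure X))
    (g : C(X, ℝ)) : C(P, ℝ) where
  toFun p := ∫ x, g x ∂((p : ProbabilityMeasure X) : Measure X)
  continuous_toFun :=
    (ProbabilityMeasure.continuous_integral_continuousMap g).comp continuous_subtype_val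

/-- Probability measures are separated by integrals of functions from a dense set. -/
theorem MeasureTheory.ProbabilityMeasure.eq_of_forall_integral_eq_of_dense {X : Type*}
    [TopologicalSpace X] [CompactSpace X] [MeasurableSpace X] [HasOuterApproxClosed X] [BorelSpace X]
    {F : Set C(X, ℝ)} (hF : Dense F) {p q : ProbabilityMeasure X}
    (h : ∀ g ∈ F, ∫ x, g x ∂(p : Measure X) = ∫ x, g x ∂(q : Measure X)) : p = q := by
  have h_eq := (ContinuousMap.continuous_integral_left (p : Measure X)).ext_on hF
    (ContinuousMap.continuous_integral_left (q : Measure X)) h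
  have h_measure : (p : Measure X) = q :=
    ext_of_forall_integral_eq_of_IsFiniteMeasure fun g ↦ congrFun h_eq g.toContinuousMap
  exact Subtype.ext h_measure

/-- An element of `Algebra.adjoin R (e '' F)` is a linear combination of products of elements
of `e '' F`. -/
theorem Algebra.exists_sum_smul_prod_of_mem_adjoin_image {R A ι : Type*} [CommSemiring R]
    [CommSemiring A] [Algebra R A] {e : ι → A} {F : Set ι} {a : A}
    (ha : a ∈ Algebra.adjoin R (e '' F)) :
    ∃ (n : ℕ) (l : Fin n → ℕ) (α : Fin n → R) (g : (i : Fin n) → Fin (l i) → ι),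
      (∀ i j, g i j ∈ F) ∧ a = ∑ i, α i • ∏ j, e (g i j) := by
  rw [← Subalgebra.mem_toSubmodule, Algebra.adjoin_eq_span, Submodule.mem_span_set'] at ha
  obtain ⟨n, α, m, rfl⟩ := ha
  have h_prod (i : Fin n) :
      ∃ (l : ℕ) (g : Fin l → ι), (∀ j, g j ∈ F) ∧ (m i : A) = ∏ j, e (g j) := by
    obtain ⟨L, hL, h_eq⟩ := Submonoid.exists_list_of_mem_closure (m i).2
    choose g hg hge using fun j : Fin L.length ↦ hL L[j] (L.getElem_mem j.2)
    refine ⟨L.length, g, hg, ?_⟩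
    simp_rw [hge, ← h_eq]
    exact (Fin.prod_univ_getElem L).symm
  choose l g hg hm using h_prod
  exact ⟨n, l, α, g, hg, by simp_rw [hm]⟩

/-- Density of ΣΠ(F) in C(P, ℝ): if F is dense in C(X, ℝ), then every continuous
real function on a compact (weak-*) set P of Borel probability measures on the
compact metric space X is uniformly approximated by functions
p ↦ ∑_{i=1}^n α_i ∏_{j=1}^{l_i} ∫ f_{ij} dp with f_{ij} ∈ F. -/
theorem stmt_5 {X : Type*} [MetricSpace X] [CompactSpace X]
    [MeasurableSpace X] [BorelSpace X]
    (P : Set (ProbabilityMeasure X)) (hP : IsCompact P)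
    (F : Set C(X, ℝ)) (hF : Dense F)
    (f : ↥P → ℝ) (hf : Continuous f) :
    ∀ ε > 0, ∃ (n : ℕ) (l : Fin n → ℕ) (α : Fin n → ℝ)
      (g : (i : Fin n) → Fin (l i) → C(X, ℝ)),
      (∀ i j, g i j ∈ F) ∧
      ∀ p : ↥P,
        |f p - ∑ i, α i * ∏ j, ∫ x, g i j x ∂((p : ProbabilityMeasure X) : Measure X)| < ε := by
  intro ε hε
  have : CompactSpace P := isCompact_iff_compactSpace.mp hP
  have h_sep : (Algebra.adjoin ℝ (integralOn P '' F)).SeparatesPoints := by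
    intro p q hpq
    by_contra! h
    refine hpq (Subtype.ext
      (ProbabilityMeasure.eq_of_forall_integral_eq_of_dense hF fun g hg ↦ ?_))
    exact h _ ⟨integralOn P g, Algebra.subset_adjoin ⟨g, hg, rfl⟩, rfl⟩
  obtain ⟨⟨a, ha⟩, h_lt⟩ :=
    ContinuousMap.exists_mem_subalgebra_near_continuous_of_separatesPoints _ h_sep f hf ε hε
  obtain ⟨n, l, α, g, hg, rfl⟩ := Algebra.exists_sum_smul_prod_of_mem_adjoin_image ha
  refine ⟨n, l, α, g, hg, fun p ↦ ?_⟩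
  rw [abs_sub_comm]
  simpa [ContinuousMap.sum_apply, ContinuousMap.prod_apply] using h_lt p
end

section
/- Let X be a compact metric space, let P be a compact (in the weak-* topology) set of Borel probability measures on X, let F be a set of continuous functions dense in C(X, ℝ), and let σ: ℝ → ℝ be continuous and not an algebraic polynomial. Then Σ(σ, A^F) is dense in C(P, ℝ): for every continuous f: P → ℝ and every ε > 0 there exist n, m_i ∈ ℕ, α_i, b_i, w_{ij} ∈ ℝ, and f_{ij} ∈ F such that sup_{p ∈ P} |f(p) − ∑_{i=1}^n α_i σ(b_i + ∑_{j=1}^{m_i} w_{ij} ∫_X f_{ij}(x) dp(x))| < ε. -/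
open MeasureTheory

/-- The space of real functions given by polynomials of degree less than `k`. -/
def polyFunLT (k : ℕ) : Submodule ℝ (ℝ → ℝ) :=
  Submodule.span ℝ ((fun (i : ℕ) (t : ℝ) => t ^ i) '' Set.Iio k)

lemma isClosed_polyFunLT (k : ℕ) : IsClosed (polyFunLT k : Set (ℝ → ℝ)) := by
  have : FiniteDimensional ℝ (polyFunLT k) :=
    FiniteDimensional.span_of_finite ℝ ((Set.finite_Iio k).image _)
  exact Submodule.closed_of_finiteDimensional _

lemma pow_mem_polyFunLT {i k : ℕ} (h : i < k) : (fun t : ℝ => t ^ i) ∈ polyFunLT k :=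
  Submodule.subset_span ⟨i, h, rfl⟩

lemma exists_polynomial_of_mem_polyFunLT {k : ℕ} {s : ℝ → ℝ} (hs : s ∈ polyFunLT k) :
    ∃ q : Polynomial ℝ, ∀ t, s t = q.eval t := by
  induction hs using Submodule.span_induction with
  | mem x h => obtain ⟨i, -, rfl⟩ := h; exact ⟨Polynomial.X ^ i, by simp⟩
  | zero => exact ⟨0, by simp⟩
  | add x y _ _ hx hy =>
    obtain ⟨p, hp⟩ := hx
    obtain ⟨q, hq⟩ := hy
    exact ⟨p + q, by simp [hp, hq]⟩
  | smul a x _ hx =>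
    obtain ⟨p, hp⟩ := hx
    exact ⟨Polynomial.C a * p, by simp [hp]⟩

lemma exists_antideriv_mem_polyFunLT {k : ℕ} {d : ℝ → ℝ} (hd : d ∈ polyFunLT k) :
    ∃ Q ∈ polyFunLT (k + 1), ∀ x, HasDerivAt Q (d x) x := by
  induction hd using Submodule.span_induction with
  | mem x h =>
    obtain ⟨i, hi, rfl⟩ := h
    refine ⟨((i : ℝ) + 1)⁻¹ • fun t : ℝ => t ^ (i + 1),
      Submodule.smul_mem _ _ (pow_mem_polyFunLT (Nat.succ_lt_succ hi)), fun x => ?_⟩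
    refine ((hasDerivAt_pow (i + 1) x).const_smul ((i : ℝ) + 1)⁻¹).congr_deriv ?_
    have : (i : ℝ) + 1 ≠ 0 := by positivity
    simp only [Nat.cast_add, Nat.cast_one, Nat.add_sub_cancel, smul_eq_mul]
    field_simp
  | zero => exact ⟨0, Submodule.zero_mem _, fun x => hasDerivAt_const x 0⟩
  | add x y _ _ hx hy =>
    obtain ⟨p, hpm, hp⟩ := hx
    obtain ⟨q, hqm, hq⟩ := hy
    exact ⟨p + q, Submodule.add_mem _ hpm hqm, fun x => (hp x).add (hq x)⟩
  | smul a x _ hx =>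
    obtain ⟨p, hpm, hp⟩ := hx
    exact ⟨a • p, Submodule.smul_mem _ _ hpm, fun x => (hp x).const_smul a⟩

lemma mem_polyFunLT_of_iteratedDeriv_eq_zero (k : ℕ) {s : ℝ → ℝ} (hs : ContDiff ℝ k s)
    (h : ∀ x, iteratedDeriv k s x = 0) : s ∈ polyFunLT k := by
  induction k generalizing s with
  | zero =>
    have : s = 0 := funext fun x => by simpa using h x
    exact this ▸ Submodule.zero_mem _
  | succ k ih =>
    have hs' : ContDiff ℝ ((k : WithTop ℕ∞) + 1) s := by exact_mod_cast hs
    have hdiff : Differentiable ℝ s := hs'.differentiable (by simp)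
    have hd : deriv s ∈ polyFunLT k :=
      ih (contDiff_succ_iff_deriv.1 hs').2.2 fun x => by
        rw [← iteratedDeriv_succ']; exact h x
    obtain ⟨Q, hQm, hQ⟩ := exists_antideriv_mem_polyFunLT hd
    have hsub : ∀ x, HasDerivAt (s - Q) 0 x := fun x => by
      simpa using (hdiff x).hasDerivAt.sub (hQ x)
    have hconst : s = Q + (s 0 - Q 0) • fun t : ℝ => t ^ 0 := by
      funext x
      have := is_const_of_deriv_eq_zero (fun x => (hsub x).differentiableAt)
        (fun x => (hsub x).deriv) x 0
      simp only [Pi.sub_apply] at this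
      simp only [pow_zero, Pi.add_apply, Pi.smul_apply, smul_eq_mul, mul_one]
      linarith
    rw [hconst]
    exact Submodule.add_mem _ hQm
      (Submodule.smul_mem _ _ (pow_mem_polyFunLT (Nat.succ_pos k)))

/-- The mollification of `σ` by a normalized bump function centred at `0`. -/
noncomputable def mollify (φ : ContDiffBump (0 : ℝ)) (σ : ℝ → ℝ) : ℝ → ℝ :=
  convolution (φ.normed volume) σ (ContinuousLinearMap.lsmul ℝ ℝ) volume

lemma contDiff_mollify (φ : ContDiffBump (0 : ℝ)) {σ : ℝ → ℝ} (hσ : Continuous σ) (n : ℕ) :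
    ContDiff ℝ n (mollify φ σ) :=
  φ.hasCompactSupport_normed.contDiff_convolution_left (n := (n : ℕ∞)) _ φ.contDiff_normed
    hσ.locallyIntegrable

lemma exists_iteratedDeriv_mollify_ne_zero {σ : ℝ → ℝ} (hσ : Continuous σ)
    (hpoly : ¬ ∃ q : Polynomial ℝ, ∀ t : ℝ, σ t = q.eval t) (k : ℕ) :
    ∃ (φ : ContDiffBump (0 : ℝ)) (b : ℝ), iteratedDeriv k (mollify φ σ) b ≠ 0 := by
  by_contra! h
  apply hpoly
  apply exists_polynomial_of_mem_polyFunLT (k := k)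
  let φ : ℕ → ContDiffBump (0 : ℝ) := fun n =>
    ⟨1 / ((n : ℝ) + 1) / 2, 1 / ((n : ℝ) + 1), by positivity, half_lt_self (by positivity)⟩
  have hφ : Filter.Tendsto (fun n => (φ n).rOut) Filter.atTop (nhds 0) :=
    tendsto_one_div_add_atTop_nhds_zero_nat
  have hlim : Filter.Tendsto (fun n => mollify (φ n) σ) Filter.atTop (nhds σ) :=
    tendsto_pi_nhds.2 fun x => ContDiffBump.convolution_tendsto_right_of_continuous hφ hσ x
  exact (isClosed_polyFunLT k).mem_of_tendsto hlim <| Filter.Eventually.of_forall fun n =>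
    mem_polyFunLT_of_iteratedDeriv_eq_zero k (contDiff_mollify _ hσ k) (h (φ n))

section Integral

variable {E : Type*} [NormedAddCommGroup E] [NormedSpace ℝ E]

lemma Submodule.integral_mem_of_isClosed_s7 [CompleteSpace E] {α : Type*} [MeasurableSpace α]
    {μ : Measure α} {V : Submodule ℝ E} (hV : IsClosed (V : Set E)) {f : α → E}
    (hf : Integrable f μ) (hmem : ∀ x, f x ∈ V) : ∫ x, f x ∂μ ∈ V := by
  by_contra hnot
  obtain ⟨L, u, hLu, hu⟩ := geometric_hahn_banach_closed_point V.convex hV hnot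
  have hL : ∀ v ∈ V, L v = 0 := fun v hv => by
    by_contra hne
    have := hLu (((u + 1) / L v) • v) (V.smul_mem _ hv)
    rw [map_smul, smul_eq_mul, div_mul_cancel₀ _ hne] at this
    linarith
  have h0 : L (∫ x, f x ∂μ) = 0 := by
    rw [← L.integral_comp_comm hf]
    simp [hL _ (hmem _)]
  have := hLu 0 V.zero_mem
  rw [map_zero] at this
  linarith

lemma Submodule.mem_of_hasDerivAt {V : Submodule ℝ E} (hV : IsClosed (V : Set E)) {c : ℝ → E}
    {c' : E} {w : ℝ} (hc : HasDerivAt c c' w) (hmem : ∀ x, c x ∈ V) : c' ∈ V :=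
  hV.mem_of_tendsto hc.tendsto_slope <| Filter.Eventually.of_forall fun x =>
    V.smul_mem _ (V.sub_mem (hmem x) (hmem w))

end Integral

section Density

variable {K : Type*} [TopologicalSpace K] [CompactSpace K]

/-- A curve in `C(K, ℝ)` with a jointly continuous pointwise derivative is differentiable
in the supremum norm. -/
lemma ContinuousMap.hasDerivAt_of_pointwise {c c' : ℝ → C(K, ℝ)} (hc' : Continuous c')
    (h : ∀ w x, HasDerivAt (fun v => c v x) (c' w x) w) (w : ℝ) : HasDerivAt c (c' w) w := by
  have heq : c = fun v => c 0 + ∫ u in (0 : ℝ)..v, c' u := by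
    funext v
    ext x
    have h1 := (ContinuousMap.evalCLM ℝ x).intervalIntegral_comp_comm
      (hc'.intervalIntegrable (μ := volume) 0 v)
    have h2 := intervalIntegral.integral_eq_sub_of_hasDerivAt (a := 0) (b := v)
      (fun u _ => h u x)
      (((ContinuousMap.evalCLM ℝ x).continuous.comp hc').intervalIntegrable 0 v)
    simp only [ContinuousMap.evalCLM_apply] at h1
    rw [ContinuousMap.add_apply, ← h1, h2]
    ring
  rw [heq]
  exact (hc'.integral_hasStrictDerivAt 0 w).hasDerivAt.const_add _

variable {A V : Submodule ℝ C(K, ℝ)} {σ : ℝ → ℝ}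

lemma mollify_comp_mem (hσ : Continuous σ) (hA : 1 ∈ A) (hV : IsClosed (V : Set C(K, ℝ)))
    (hmem : ∀ a ∈ A, (⟨σ, hσ⟩ : C(ℝ, ℝ)).comp a ∈ V) (φ : ContDiffBump (0 : ℝ))
    (f : C(K, ℝ)) {a : C(K, ℝ)} (ha : a ∈ A) (hf : ∀ x, f x = mollify φ σ (a x)) : f ∈ V := by
  let Φ : ℝ → C(K, ℝ) := fun u =>
    φ.normed volume u • (⟨σ, hσ⟩ : C(ℝ, ℝ)).comp (a - u • (1 : C(K, ℝ)))
  have hcont : Continuous Φ := by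
    refine ContinuousMap.continuous_of_continuous_uncurry _ ?_
    have := φ.continuous_normed (μ := volume)
    simp only [Φ, Function.uncurry_def, ContinuousMap.smul_apply, ContinuousMap.comp_apply,
      ContinuousMap.sub_apply, ContinuousMap.one_apply, ContinuousMap.coe_mk]
    fun_prop
  have hΦ : Integrable Φ :=
    hcont.integrable_of_hasCompactSupport φ.hasCompactSupport_normed.smul_right
  have hfint : f = ∫ u, Φ u := by
    ext x
    rw [ContinuousMap.integral_apply hΦ, hf, mollify, convolution_def]
    simp [Φ]
  rw [hfint]
  exact Submodule.integral_mem_of_isClosed_s7 hV hΦ fun u =>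
    V.smul_mem _ (hmem _ (A.sub_mem ha (A.smul_mem u hA)))

lemma iteratedDeriv_comp_mul_pow_mem {s : ℝ → ℝ} (hs : ∀ n : ℕ, ContDiff ℝ n s)
    (hV : IsClosed (V : Set C(K, ℝ))) (a : C(K, ℝ)) (b : ℝ)
    (hmem : ∀ (w : ℝ) (f : C(K, ℝ)), (∀ x, f x = s (w * a x + b)) → f ∈ V) (k : ℕ) :
    ∀ (w : ℝ) (f : C(K, ℝ)),
      (∀ x, f x = iteratedDeriv k s (w * a x + b) * a x ^ k) → f ∈ V := by
  induction k with
  | zero => simpa using hmem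
  | succ k ih =>
    intro w f hf
    have hcd : ∀ n, Continuous (iteratedDeriv n s) := fun n =>
      (hs n).continuous_iteratedDeriv n le_rfl
    let c : ℕ → ℝ → C(K, ℝ) := fun n v =>
      ⟨fun x => iteratedDeriv n s (v * a x + b) * a x ^ n, by
        have := hcd n
        fun_prop⟩
    have hc' : Continuous (c (k + 1)) := by
      refine ContinuousMap.continuous_of_continuous_uncurry _ ?_
      have := hcd (k + 1)
      simp only [c, Function.uncurry_def, ContinuousMap.coe_mk]
      fun_prop
    have hderiv : ∀ v x, HasDerivAt (fun v => c k v x) (c (k + 1) v x) v := by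
      intro v x
      have h1 : HasDerivAt (iteratedDeriv k s) (iteratedDeriv (k + 1) s (v * a x + b))
          (v * a x + b) := by
        rw [iteratedDeriv_succ]
        exact ((hs (k + 1)).differentiable_iteratedDeriv k
          (by exact_mod_cast Nat.lt_succ_self k) _).hasDerivAt
      have h2 : HasDerivAt (fun v => v * a x + b) (a x) v := by
        simpa using ((hasDerivAt_id v).mul_const (a x)).add_const b
      refine ((h1.comp v h2).mul_const (a x ^ k)).congr_deriv ?_
      simp only [c, ContinuousMap.coe_mk]
      ring
    have hfc : f = c (k + 1) w := ContinuousMap.ext hf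
    rw [hfc]
    exact Submodule.mem_of_hasDerivAt hV (ContinuousMap.hasDerivAt_of_pointwise hc' hderiv w)
      fun v => ih v _ fun x => rfl

lemma pow_mem_of_comp_mem (hσ : Continuous σ)
    (hpoly : ¬ ∃ q : Polynomial ℝ, ∀ t : ℝ, σ t = q.eval t)
    (hA : 1 ∈ A) (hV : IsClosed (V : Set C(K, ℝ)))
    (hmem : ∀ a ∈ A, (⟨σ, hσ⟩ : C(ℝ, ℝ)).comp a ∈ V) {a : C(K, ℝ)} (ha : a ∈ A) (k : ℕ) :
    a ^ k ∈ V := by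
  obtain ⟨φ, b, hb⟩ := exists_iteratedDeriv_mollify_ne_zero hσ hpoly k
  have h := iteratedDeriv_comp_mul_pow_mem (fun n => contDiff_mollify φ hσ n) hV a b
    (fun w f hf => mollify_comp_mem hσ hA hV hmem φ f
      (A.add_mem (A.smul_mem w ha) (A.smul_mem b hA)) (by simpa using hf)) k 0
    (iteratedDeriv k (mollify φ σ) b • a ^ k) (by simp)
  exact (V.smul_mem_iff hb).1 h

/-- If a closed subspace of `C(K, ℝ)` contains all powers of the elements of a point-separating
subspace, it is everything: it contains the algebra spanned by exponentials. -/
lemma eq_top_of_pow_mem (hV : IsClosed (V : Set C(K, ℝ)))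
    (hsep : ∀ x y : K, x ≠ y → ∃ a ∈ A, a x ≠ a y)
    (hpow : ∀ a ∈ A, ∀ k : ℕ, a ^ k ∈ V) : V = ⊤ := by
  let e : C(K, ℝ) → C(K, ℝ) := fun a => (⟨Real.exp, Real.continuous_exp⟩ : C(ℝ, ℝ)).comp a
  have he : ∀ a ∈ A, e a ∈ V := by
    intro a ha
    have hsum := NormedSpace.exp_series_hasSum_exp' (𝕂 := ℝ) a
    have heq : NormedSpace.exp a = e a := by
      ext x
      have h1 := hsum.map (ContinuousMap.evalCLM ℝ x) (ContinuousMap.evalCLM ℝ x).continuous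
      have h2 := NormedSpace.exp_series_hasSum_exp' (𝕂 := ℝ) (a x)
      rw [← Real.exp_eq_exp_ℝ] at h2
      exact h1.unique h2
    rw [← heq]
    exact hV.mem_of_tendsto hsum <| Filter.Eventually.of_forall fun t =>
      V.sum_mem fun k _ => V.smul_mem _ (hpow a ha k)
  let M : Submonoid C(K, ℝ) :=
    { carrier := e '' A
      one_mem' := ⟨0, A.zero_mem, by ext; simp [e]⟩
      mul_mem' := by
        rintro _ _ ⟨a, ha, rfl⟩ ⟨b, hb, rfl⟩
        exact ⟨a + b, A.add_mem ha hb, by ext; simp [e, Real.exp_add]⟩ }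
  have hle : Subalgebra.toSubmodule (Algebra.adjoin ℝ (M : Set C(K, ℝ))) ≤ V := by
    rw [Algebra.adjoin_eq_span, Submonoid.closure_eq, Submodule.span_le]
    rintro _ ⟨a, ha, rfl⟩
    exact he a ha
  have hdense := ContinuousMap.subalgebra_topologicalClosure_eq_top_of_separatesPoints
    (Algebra.adjoin ℝ (M : Set C(K, ℝ))) (by
      intro x y hxy
      obtain ⟨a, ha, hne⟩ := hsep x y hxy
      refine ⟨e a, ⟨e a, Algebra.subset_adjoin ⟨a, ha, rfl⟩, rfl⟩, ?_⟩
      simpa [e] using hne)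
  rw [eq_top_iff]
  intro f _
  have hf : f ∈ (Algebra.adjoin ℝ (M : Set C(K, ℝ))).topologicalClosure := by
    rw [hdense]; trivial
  exact closure_minimal hle hV hf

end Density

section Integration

variable {X : Type*} [MetricSpace X] [CompactSpace X] [MeasurableSpace X] [BorelSpace X]

/-- The function `p ↦ ∫ g dp` on a set of probability measures. -/
noncomputable def integralMap (P : Set (ProbabilityMeasure X)) (g : C(X, ℝ)) : C(P, ℝ) :=
  ⟨fun p => ∫ x, g x ∂((p : ProbabilityMeasure X) : Measure X),
    (ProbabilityMeasure.continuous_integral_boundedContinuousFunction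
      (BoundedContinuousFunction.mkOfCompact g)).comp continuous_subtype_val⟩

lemma continuous_integral_continuousMap (μ : Measure X) [IsFiniteMeasure μ] :
    Continuous fun g : C(X, ℝ) => ∫ x, g x ∂μ := by
  refine continuous_iff_continuousAt.2 fun g => ?_
  refine tendsto_integral_filter_of_dominated_convergence (fun _ => ‖g‖ + 1) ?_ ?_
    (integrable_const _) ?_
  · exact Filter.Eventually.of_forall fun h => h.continuous.aestronglyMeasurable
  · have : ∀ᶠ h : C(X, ℝ) in nhds g, ‖h‖ < ‖g‖ + 1 :=
      continuous_norm.continuousAt.eventually_lt continuousAt_const (by simp)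
    filter_upwards [this] with h hh
    exact Filter.Eventually.of_forall fun x => (h.norm_coe_le_norm x).trans hh.le
  · exact Filter.Eventually.of_forall fun x => (ContinuousMap.evalCLM ℝ x).continuous.tendsto g

lemma exists_integralMap_ne (P : Set (ProbabilityMeasure X)) {F : Set C(X, ℝ)} (hF : Dense F)
    {p q : P} (hpq : p ≠ q) : ∃ g ∈ F, integralMap P g p ≠ integralMap P g q := by
  by_contra! h
  apply hpq
  have heq := (continuous_integral_continuousMap
    ((p : ProbabilityMeasure X) : Measure X)).ext_on hF
    (continuous_integral_continuousMap ((q : ProbabilityMeasure X) : Measure X)) h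
  have hmeas : ((p : ProbabilityMeasure X) : Measure X) = (q : ProbabilityMeasure X) :=
    ext_of_forall_integral_eq_of_IsFiniteMeasure fun f => congrFun heq f.toContinuousMap
  exact Subtype.ext (Subtype.ext hmeas)

lemma exists_eq_of_mem_span_insert_one (P : Set (ProbabilityMeasure X)) {F : Set C(X, ℝ)}
    {a : C(P, ℝ)} (ha : a ∈ Submodule.span ℝ (insert 1 (integralMap P '' F))) :
    ∃ (m : ℕ) (b : ℝ) (w : Fin m → ℝ) (g : Fin m → C(X, ℝ)), (∀ j, g j ∈ F) ∧
      ∀ p : P, a p = b + ∑ j, w j * ∫ x, g j x ∂((p : ProbabilityMeasure X) : Measure X) := by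
  obtain ⟨b, z, hz, rfl⟩ := Submodule.mem_span_insert.1 ha
  obtain ⟨m, w, y, rfl⟩ := Submodule.mem_span_set'.1 hz
  choose g hgF hg using fun j => (y j).2
  refine ⟨m, b, w, g, hgF, fun p => ?_⟩
  simp only [← hg, ContinuousMap.add_apply, ContinuousMap.smul_apply, ContinuousMap.one_apply,
    smul_eq_mul, mul_one, ContinuousMap.sum_apply]
  rfl

end Integration

/-- Universal approximation on probability spaces: for F dense in C(X, ℝ) and a
continuous non-polynomial σ, the class Σ(σ, A^F) of functions
p ↦ ∑_{i=1}^n α_i σ(b_i + ∑_{j=1}^{m_i} w_{ij} ∫ f_{ij} dp), f_{ij} ∈ F,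
is dense in C(P, ℝ) for any compact (weak-*) set P of Borel probability
measures on the compact metric space X. -/
theorem stmt_7 {X : Type*} [MetricSpace X] [CompactSpace X]
    [MeasurableSpace X] [BorelSpace X]
    (P : Set (ProbabilityMeasure X)) (hP : IsCompact P)
    (F : Set C(X, ℝ)) (hF : Dense F)
    (σ : ℝ → ℝ) (hσ_cont : Continuous σ)
    (hσ_nonpoly : ¬ ∃ q : Polynomial ℝ, ∀ t : ℝ, σ t = q.eval t)
    (f : ↥P → ℝ) (hf : Continuous f) :
    ∀ ε > 0, ∃ (n : ℕ) (m : Fin n → ℕ) (α : Fin n → ℝ) (b : Fin n → ℝ)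
      (w : (i : Fin n) → Fin (m i) → ℝ)
      (g : (i : Fin n) → Fin (m i) → C(X, ℝ)),
      (∀ i j, g i j ∈ F) ∧
      ∀ p : ↥P,
        |f p - ∑ i, α i * σ (b i + ∑ j, w i j *
          ∫ x, g i j x ∂((p : ProbabilityMeasure X) : Measure X))| < ε := by
  intro ε hε
  have : CompactSpace P := isCompact_iff_compactSpace.1 hP
  let A : Submodule ℝ C(P, ℝ) := Submodule.span ℝ (insert 1 (integralMap P '' F))
  let S : Set C(P, ℝ) := (fun a => (⟨σ, hσ_cont⟩ : C(ℝ, ℝ)).comp a) '' A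
  have htop : (Submodule.span ℝ S).topologicalClosure = ⊤ := by
    have hclosed := (Submodule.span ℝ S).isClosed_topologicalClosure
    refine eq_top_of_pow_mem (A := A) hclosed (fun p q hpq => ?_) fun a ha k =>
      pow_mem_of_comp_mem hσ_cont hσ_nonpoly (A := A)
        (Submodule.subset_span (Set.mem_insert _ _)) hclosed (fun a ha =>
          Submodule.le_topologicalClosure _ (Submodule.subset_span ⟨a, ha, rfl⟩)) ha k
    obtain ⟨g, hg, hne⟩ := exists_integralMap_ne P hF hpq
    exact ⟨_, Submodule.subset_span (Set.mem_insert_of_mem _ ⟨g, hg, rfl⟩), hne⟩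
  have hmem : (⟨f, hf⟩ : C(P, ℝ)) ∈ closure (Submodule.span ℝ S : Set C(P, ℝ)) := by
    rw [← Submodule.topologicalClosure_coe, htop]
    trivial
  obtain ⟨h, hh, hdist⟩ := Metric.mem_closure_iff.1 hmem ε hε
  obtain ⟨n, α, y, rfl⟩ := Submodule.mem_span_set'.1 hh
  choose a haA ha using fun i => (y i).2
  choose m b w g hgF hg using fun i => exists_eq_of_mem_span_insert_one P (haA i)
  refine ⟨n, m, α, b, w, g, hgF, fun p => ?_⟩
  have := (ContinuousMap.dist_lt_iff hε).1 hdist p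
  simpa [Real.dist_eq, ← ha, hg] using this
end
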